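/- The surface divergence theorem with curvature term holds: ∫_Q (div_Γ X) √(1+|∇_*η|²) dx = −∫_Q (X · ν) H √(1+|∇_*η|²) dx. -/

import Mathlib

open Real MeasureTheory

noncomputable section

/-- The horizontal plane ℝ². -/
abbrev E2 := EuclideanSpace ℝ (Fin 2)

/-- Partial derivative ∂ᵢ of a function on ℝ². -/
noncomputable def pd (i : Fin 2) (f : E2 → ℝ) : E2 → ℝ :=
  fun x => fderiv ℝ f x (EuclideanSpace.single i 1)

/-- 1 + |∇_*η|². -/
noncomputable def nsq (η : E2 → ℝ) (x : E2) : ℝ :=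
  1 + ((pd 0 η x) ^ 2 + (pd 1 η x) ^ 2)

/-- The unit normal ν = (−∂₁η, −∂₂η, 1)/√(1+|∇_*η|²). -/
noncomputable def nu (η : E2 → ℝ) (i : Fin 3) (x : E2) : ℝ :=
  ![-(pd 0 η x), -(pd 1 η x), 1] i / Real.sqrt (nsq η x)

/-- The tangential derivative factor ν₁∂₁f + ν₂∂₂f. -/
noncomputable def tang (η f : E2 → ℝ) (x : E2) : ℝ :=
  nu η 0 x * pd 0 f x + nu η 1 x * pd 1 f x

/-- The surface derivatives ∂_{Γ,i}. -/
noncomputable def surfD (η : E2 → ℝ) (i : Fin 3) (f : E2 → ℝ) : E2 → ℝ :=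
  fun x => ![pd 0 f x, pd 1 f x, (0 : ℝ)] i - nu η i x * tang η f x

/-- Surface divergence div_Γ X = Σᵢ ∂_{Γ,i} Xᵢ. -/
noncomputable def divGamma (η : E2 → ℝ) (X : Fin 3 → E2 → ℝ) (x : E2) : ℝ :=
  ∑ i : Fin 3, surfD η i (X i) x

/-- Surface Laplacian Δ_Γ g = div_Γ (∇_Γ g). -/
noncomputable def lapGamma (η g : E2 → ℝ) (x : E2) : ℝ :=
  ∑ i : Fin 3, surfD η i (surfD η i g) x

/-- The mean curvature H = div_*(∇_*η/√(1+|∇_*η|²)). -/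
noncomputable def meanH (η : E2 → ℝ) (x : E2) : ℝ :=
  pd 0 (fun y => pd 0 η y / Real.sqrt (nsq η y)) x
    + pd 1 (fun y => pd 1 η y / Real.sqrt (nsq η y)) x

/-- Periodicity with periods L₁, L₂ in the two horizontal directions. -/
def PeriodicE2 (L₁ L₂ : ℝ) (f : E2 → ℝ) : Prop :=
  (∀ x : E2, f (x + L₁ • EuclideanSpace.single 0 1) = f x) ∧
  (∀ x : E2, f (x + L₂ • EuclideanSpace.single 1 1) = f x)

/-- The fundamental periodicity cell Q = [0,L₁] × [0,L₂]. -/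
def Q2 (L₁ L₂ : ℝ) : Set E2 := {x : E2 | x 0 ∈ Set.Icc 0 L₁ ∧ x 1 ∈ Set.Icc 0 L₂}

end

lemma pd_add' (i : Fin 2) {f g : E2 → ℝ} {x : E2} (hf : DifferentiableAt ℝ f x)
    (hg : DifferentiableAt ℝ g x) : pd i (fun y => f y + g y) x = pd i f x + pd i g x := by
  unfold pd
  rw [fderiv_fun_add hf hg]; rfl

lemma pd_sub' (i : Fin 2) {f g : E2 → ℝ} {x : E2} (hf : DifferentiableAt ℝ f x)
    (hg : DifferentiableAt ℝ g x) : pd i (fun y => f y - g y) x = pd i f x - pd i g x := by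
  unfold pd
  rw [fderiv_fun_sub hf hg]; rfl

lemma pd_mul' (i : Fin 2) {f g : E2 → ℝ} {x : E2} (hf : DifferentiableAt ℝ f x)
    (hg : DifferentiableAt ℝ g x) :
    pd i (fun y => f y * g y) x = f x * pd i g x + g x * pd i f x := by
  unfold pd
  rw [fderiv_fun_mul hf hg]; simp

lemma contDiff_pd (i : Fin 2) {f : E2 → ℝ} (hf : ContDiff ℝ 2 f) : ContDiff ℝ 1 (pd i f) := by
  unfold pd
  exact (hf.fderiv_right (m := 1) (by norm_num)).clm_apply contDiff_const

lemma continuous_pd (i : Fin 2) {f : E2 → ℝ} (hf : ContDiff ℝ 1 f) : Continuous (pd i f) := by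
  unfold pd
  exact (hf.continuous_fderiv (by norm_num)).clm_apply continuous_const

lemma pd_comm {f : E2 → ℝ} (hf : ContDiff ℝ 2 f) (i j : Fin 2) (x : E2) :
    pd i (pd j f) x = pd j (pd i f) x := by
  have hd : DifferentiableAt ℝ (fderiv ℝ f) x :=
    ((hf.fderiv_right (m := 1) (by norm_num)).differentiable (by norm_num)) x
  have key : ∀ v w : E2, fderiv ℝ (fun y => fderiv ℝ f y v) x w
      = fderiv ℝ (fderiv ℝ f) x w v := by
    intro v w
    rw [fderiv_clm_apply hd (differentiableAt_const _)]
    simp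
  have hs : IsSymmSndFDerivAt ℝ f x := hf.contDiffAt.isSymmSndFDerivAt (by simp)
  unfold pd
  rw [key, key]
  exact hs _ _

lemma nsq_pos (η : E2 → ℝ) (x : E2) : 0 < nsq η x := by
  unfold nsq; positivity

lemma contDiff_sqrt_nsq {η : E2 → ℝ} (hη : ContDiff ℝ 2 η) :
    ContDiff ℝ 1 (fun x => Real.sqrt (nsq η x)) := by
  refine ContDiff.sqrt ?_ (fun x => (nsq_pos η x).ne')
  unfold nsq
  exact contDiff_const.add (((contDiff_pd 0 hη).pow 2).add ((contDiff_pd 1 hη).pow 2))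

lemma pd_sqrt_nsq {η : E2 → ℝ} (hη : ContDiff ℝ 2 η) (i : Fin 2) (x : E2) :
    Real.sqrt (nsq η x) * pd i (fun x => Real.sqrt (nsq η x)) x
      = pd 0 η x * pd i (pd 0 η) x + pd 1 η x * pd i (pd 1 η) x := by
  have hs := (contDiff_sqrt_nsq hη).differentiable (by norm_num) x
  have h0 := (contDiff_pd 0 hη).differentiable (by norm_num) x
  have h1 := (contDiff_pd 1 hη).differentiable (by norm_num) x
  have e : (fun y => Real.sqrt (nsq η y) * Real.sqrt (nsq η y))
      = fun y => 1 + (pd 0 η y * pd 0 η y + pd 1 η y * pd 1 η y) := by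
    funext y
    rw [Real.mul_self_sqrt (nsq_pos η y).le]
    unfold nsq; ring
  have h2 := congrArg (fun f => pd i f x) e
  beta_reduce at h2
  rw [pd_mul' i hs hs, pd_add' i (differentiableAt_const _) ((h0.fun_mul h0).fun_add (h1.fun_mul h1)),
    pd_add' i (h0.fun_mul h0) (h1.fun_mul h1), pd_mul' i h0 h0, pd_mul' i h1 h1] at h2
  have h3 : pd i (fun _ : E2 => (1 : ℝ)) x = 0 := by unfold pd; simp
  linarith

lemma pd_periodic {v : E2} {f : E2 → ℝ} (h : ∀ x, f (x + v) = f x) (i : Fin 2) (x : E2) :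
    pd i f (x + v) = pd i f x := by
  unfold pd
  rw [← fderiv_comp_add_right]
  simp only [h]

/-- Auxiliary vector field whose divergence is the difference of the integrands. -/
noncomputable def auxF (η : E2 → ℝ) (X : Fin 3 → E2 → ℝ) (j : Fin 2) (Y : E2 → ℝ) (x : E2) : ℝ :=
  Real.sqrt (nsq η x) * Y x
    + (X 2 x - (X 0 x * pd 0 η x + X 1 x * pd 1 η x)) * (pd j η x / Real.sqrt (nsq η x))

lemma auxF_contDiff {η : E2 → ℝ} {X : Fin 3 → E2 → ℝ} (hη : ContDiff ℝ 2 η)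
    (hX : ∀ i, ContDiff ℝ 1 (X i)) (j : Fin 2) {Y : E2 → ℝ} (hY : ContDiff ℝ 1 Y) :
    ContDiff ℝ 1 (auxF η X j Y) := by
  have hs := contDiff_sqrt_nsq hη
  unfold auxF
  exact (hs.mul hY).add (((hX 2).sub (((hX 0).mul (contDiff_pd 0 hη)).add
    ((hX 1).mul (contDiff_pd 1 hη)))).mul ((contDiff_pd j hη).div hs
      (fun x => (Real.sqrt_pos.2 (nsq_pos η x)).ne')))

lemma auxF_shift {η : E2 → ℝ} {X : Fin 3 → E2 → ℝ} {v : E2} (h : ∀ x, η (x + v) = η x)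
    (hX : ∀ i x, X i (x + v) = X i x) (j : Fin 2) {Y : E2 → ℝ} (hY : ∀ x, Y (x + v) = Y x)
    (x : E2) : auxF η X j Y (x + v) = auxF η X j Y x := by
  simp only [auxF, nsq, pd_periodic h, hX, hY]

lemma pd_auxF {η : E2 → ℝ} {X : Fin 3 → E2 → ℝ} (hη : ContDiff ℝ 2 η)
    (hX : ∀ i, ContDiff ℝ 1 (X i)) (j : Fin 2) {Y : E2 → ℝ} (hY : ContDiff ℝ 1 Y) (x : E2) :
    pd j (auxF η X j Y) x =
      (Real.sqrt (nsq η x) * pd j Y x + Y x * pd j (fun x => Real.sqrt (nsq η x)) x)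
      + ((X 2 x - (X 0 x * pd 0 η x + X 1 x * pd 1 η x))
          * pd j (fun y => pd j η y / Real.sqrt (nsq η y)) x
        + (pd j η x / Real.sqrt (nsq η x)) * (pd j (X 2) x
          - ((X 0 x * pd j (pd 0 η) x + pd 0 η x * pd j (X 0) x)
            + (X 1 x * pd j (pd 1 η) x + pd 1 η x * pd j (X 1) x)))) := by
  have d : ∀ {f : E2 → ℝ}, ContDiff ℝ 1 f → DifferentiableAt ℝ f x :=
    fun h => h.differentiable (by norm_num) x
  have hs := contDiff_sqrt_nsq hη
  have h0 := contDiff_pd 0 hη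
  have h1 := contDiff_pd 1 hη
  have hu : ContDiff ℝ 1 (fun y => pd j η y / Real.sqrt (nsq η y)) :=
    (contDiff_pd j hη).div hs (fun x => (Real.sqrt_pos.2 (nsq_pos η x)).ne')
  have ha := (hX 0).mul h0
  have hb := (hX 1).mul h1
  have hc := (hX 2).sub (ha.add hb)
  unfold auxF
  rw [pd_add' j (d (hs.mul hY)) (d (hc.mul hu)), pd_mul' j (d hs) (d hY),
    pd_mul' j (d hc) (d hu), pd_sub' j (d (hX 2)) (d (ha.add hb)), pd_add' j (d ha) (d hb),
    pd_mul' j (d (hX 0)) (d h0), pd_mul' j (d (hX 1)) (d h1)]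

lemma pointwise_id {η : E2 → ℝ} {X : Fin 3 → E2 → ℝ} (hη : ContDiff ℝ 2 η)
    (hX : ∀ i, ContDiff ℝ 1 (X i)) (x : E2) :
    divGamma η X x * Real.sqrt (nsq η x) =
      (pd 0 (auxF η X 0 (X 0)) x + pd 1 (auxF η X 1 (X 1)) x)
      - (∑ i : Fin 3, X i x * nu η i x) * meanH η x * Real.sqrt (nsq η x) := by
  rw [pd_auxF hη hX 0 (hX 0), pd_auxF hη hX 1 (hX 1)]
  have e0 := pd_sqrt_nsq hη 0 x
  have e1 := pd_sqrt_nsq hη 1 x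
  have hc := pd_comm hη 1 0 x
  have hs : Real.sqrt (nsq η x) ≠ 0 := (Real.sqrt_pos.2 (nsq_pos η x)).ne'
  simp only [divGamma, surfD, tang, meanH, Fin.sum_univ_three, nu, Matrix.cons_val_zero,
    Matrix.cons_val_one, Matrix.cons_val]
  rw [hc]
  generalize pd 0 (fun y => pd 0 η y / Real.sqrt (nsq η y)) x = A
  generalize pd 1 (fun y => pd 1 η y / Real.sqrt (nsq η y)) x = B
  generalize pd 0 (fun x => Real.sqrt (nsq η x)) x = C at *
  generalize pd 1 (fun x => Real.sqrt (nsq η x)) x = D at *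
  generalize Real.sqrt (nsq η x) = s at *
  rw [hc] at e1
  field_simp
  linear_combination (-X 0 x) * e0 - X 1 x * e1

lemma setIntegral_Q2 (L₁ L₂ : ℝ) (g : E2 → ℝ) :
    ∫ x in Q2 L₁ L₂, g x
      = ∫ z in Set.Icc 0 L₁ ×ˢ Set.Icc 0 L₂, g (WithLp.toLp 2 ![z.1, z.2]) := by
  have hmp : MeasurePreserving
      (fun z : ℝ × ℝ => (WithLp.toLp 2 ![z.1, z.2] : E2)) volume volume :=
    (EuclideanSpace.volume_preserving_symm_measurableEquiv_toLp (Fin 2)).symm.comp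
      (volume_preserving_finTwoArrow ℝ).symm
  have hme : MeasurableEmbedding (fun z : ℝ × ℝ => (WithLp.toLp 2 ![z.1, z.2] : E2)) :=
    ((MeasurableEquiv.finTwoArrow (α := ℝ)).symm.trans
      (MeasurableEquiv.toLp 2 (Fin 2 → ℝ))).measurableEmbedding
  rw [← hmp.setIntegral_preimage_emb hme]
  rfl

lemma ftc_line {F : E2 → ℝ} (hF : ContDiff ℝ 1 F) (i : Fin 2) {L : ℝ} (hL : 0 < L) (c : ℝ → E2)
    (hc : ∀ t, c t = c 0 + t • EuclideanSpace.single i 1)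
    (hp : ∀ x : E2, F (x + L • EuclideanSpace.single i 1) = F x) :
    ∫ t in Set.Icc 0 L, pd i F (c t) = 0 := by
  have hcd : ∀ t, HasDerivAt c (EuclideanSpace.single i 1) t := by
    intro t
    have h : HasDerivAt (fun t : ℝ => c 0 + t • (EuclideanSpace.single i 1 : E2))
        ((1 : ℝ) • EuclideanSpace.single i 1) t :=
      ((hasDerivAt_id t).smul_const _).const_add _
    rw [one_smul] at h
    rwa [← funext hc] at h
  have hd : ∀ t, HasDerivAt (fun t => F (c t)) (pd i F (c t)) t := fun t =>
    ((hF.differentiable (by norm_num) (c t)).hasFDerivAt).comp_hasDerivAt t (hcd t)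
  have hcc : Continuous c := continuous_iff_continuousAt.2 fun t => (hcd t).continuousAt
  rw [integral_Icc_eq_integral_Ioc, ← intervalIntegral.integral_of_le hL.le,
    intervalIntegral.integral_eq_sub_of_hasDerivAt (fun t _ => hd t)
      (((continuous_pd i hF).comp hcc).intervalIntegrable _ _), hc L, hp, sub_self]

lemma continuous_mk2 : Continuous (fun z : ℝ × ℝ => (WithLp.toLp 2 ![z.1, z.2] : E2)) := by
  refine (PiLp.continuous_toLp 2 _).comp (continuous_pi fun i => ?_)
  fin_cases i
  · exact continuous_fst
  · exact continuous_snd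

lemma integrableOn_Q2' (L₁ L₂ : ℝ) {g : E2 → ℝ} (hg : Continuous g) :
    IntegrableOn (fun z : ℝ × ℝ => g (WithLp.toLp 2 ![z.1, z.2]))
      (Set.Icc 0 L₁ ×ˢ Set.Icc 0 L₂) volume :=
  (hg.comp continuous_mk2).continuousOn.integrableOn_compact (isCompact_Icc.prod isCompact_Icc)

lemma integral_pd0 {L₁ L₂ : ℝ} (hL₁ : 0 < L₁) {F : E2 → ℝ} (hF : ContDiff ℝ 1 F)
    (hp : PeriodicE2 L₁ L₂ F) : ∫ x in Q2 L₁ L₂, pd 0 F x = 0 := by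
  rw [setIntegral_Q2]
  have hi := integrableOn_Q2' L₁ L₂ (continuous_pd 0 hF)
  rw [Measure.volume_eq_prod] at hi ⊢
  rw [← Measure.prod_restrict]
  rw [IntegrableOn, ← Measure.prod_restrict] at hi
  rw [integral_prod_symm _ hi]
  refine integral_eq_zero_of_ae (Filter.Eventually.of_forall fun b => ?_)
  refine ftc_line hF 0 hL₁ (fun t => WithLp.toLp 2 ![t, b]) (fun t => ?_) hp.1
  ext k; fin_cases k <;> simp

lemma integral_pd1 {L₁ L₂ : ℝ} (hL₂ : 0 < L₂) {F : E2 → ℝ} (hF : ContDiff ℝ 1 F)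
    (hp : PeriodicE2 L₁ L₂ F) : ∫ x in Q2 L₁ L₂, pd 1 F x = 0 := by
  rw [setIntegral_Q2]
  have hi := integrableOn_Q2' L₁ L₂ (continuous_pd 1 hF)
  rw [Measure.volume_eq_prod] at hi ⊢
  rw [setIntegral_prod _ hi]
  refine integral_eq_zero_of_ae (Filter.Eventually.of_forall fun a => ?_)
  refine ftc_line hF 1 hL₂ (fun t => WithLp.toLp 2 ![a, t]) (fun t => ?_) hp.2
  ext k; fin_cases k <;> simp

/-- Surface divergence theorem with curvature term:
∫_Q (div_Γ X) √(1+|∇_*η|²) = −∫_Q (X·ν) H √(1+|∇_*η|²). -/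
theorem surf_div_thm (L₁ L₂ : ℝ) (hL₁ : 0 < L₁) (hL₂ : 0 < L₂)
    (η : E2 → ℝ) (X : Fin 3 → E2 → ℝ) (hη : ContDiff ℝ 2 η)
    (hX : ∀ i, ContDiff ℝ 1 (X i))
    (hηp : PeriodicE2 L₁ L₂ η) (hXp : ∀ i, PeriodicE2 L₁ L₂ (X i)) :
    ∫ x in Q2 L₁ L₂, divGamma η X x * Real.sqrt (nsq η x)
      = -∫ x in Q2 L₁ L₂,
          (∑ i : Fin 3, X i x * nu η i x) * meanH η x * Real.sqrt (nsq η x) := by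
  have hF0 := auxF_contDiff hη hX 0 (hX 0)
  have hF1 := auxF_contDiff hη hX 1 (hX 1)
  have hP0 : PeriodicE2 L₁ L₂ (auxF η X 0 (X 0)) :=
    ⟨auxF_shift hηp.1 (fun i => (hXp i).1) 0 (hXp 0).1,
      auxF_shift hηp.2 (fun i => (hXp i).2) 0 (hXp 0).2⟩
  have hP1 : PeriodicE2 L₁ L₂ (auxF η X 1 (X 1)) :=
    ⟨auxF_shift hηp.1 (fun i => (hXp i).1) 1 (hXp 1).1,
      auxF_shift hηp.2 (fun i => (hXp i).2) 1 (hXp 1).2⟩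
  have hs := contDiff_sqrt_nsq hη
  have hs0 : ∀ x, Real.sqrt (nsq η x) ≠ 0 := fun x => (Real.sqrt_pos.2 (nsq_pos η x)).ne'
  have hu : ∀ j, ContDiff ℝ 1 (fun y => pd j η y / Real.sqrt (nsq η y)) :=
    fun j => (contDiff_pd j hη).div hs hs0
  have hH : Continuous (meanH η) := (continuous_pd 0 (hu 0)).add (continuous_pd 1 (hu 1))
  have hnu : ∀ i, Continuous (nu η i) := by
    intro i
    unfold nu
    refine Continuous.div ?_ hs.continuous hs0
    fin_cases i
    · exact (contDiff_pd 0 hη).continuous.neg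
    · exact (contDiff_pd 1 hη).continuous.neg
    · exact continuous_const
  have hR : Continuous (fun x =>
      (∑ i : Fin 3, X i x * nu η i x) * meanH η x * Real.sqrt (nsq η x)) :=
    ((continuous_finsetSum _ fun i _ => (hX i).continuous.mul (hnu i)).mul hH).mul hs.continuous
  have i0 := integral_pd0 hL₁ hF0 hP0
  have i1 := integral_pd1 hL₂ hF1 hP1
  rw [setIntegral_Q2] at i0 i1
  rw [setIntegral_Q2, setIntegral_Q2]
  simp only [pointwise_id hη hX]
  have I0 := integrableOn_Q2' L₁ L₂ (continuous_pd 0 hF0)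
  have I1 := integrableOn_Q2' L₁ L₂ (continuous_pd 1 hF1)
  have IR := integrableOn_Q2' L₁ L₂ hR
  refine (integral_sub (I0.add I1) IR).trans ?_
  rw [show (∫ z in Set.Icc 0 L₁ ×ˢ Set.Icc 0 L₂, ((fun z : ℝ × ℝ => pd 0 (auxF η X 0 (X 0)) !₂[z.1, z.2])
      + fun z : ℝ × ℝ => pd 1 (auxF η X 1 (X 1)) !₂[z.1, z.2]) z) = 0 from
    (integral_add I0 I1).trans (by rw [i0, i1, add_zero])]
  simp
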